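/- For all reals a⁻, a⁺ ≥ 0 with min{a⁻, a⁺} ∈ (0,1) there exist constants c, C > 0 depending only on a⁻ and a⁺ such that for all integers N⁻, N⁺ ≥ 0 with N⁻ + N⁺ ≥ 1, the spectral gap λ of the Metropolis chain for the measure π on {−N⁻,…,N⁺} satisfies c/(N⁻+N⁺)² ≤ λ ≤ C/(N⁻+N⁺)². -/

import Mathlib

open Finset

/-- The unnormalized density `F(x) = (1+|x|)^{a⁻}` for `x ≤ 0` and
`(1+|x|)^{a⁺}` for `x > 0` on `ℤ`. -/
noncomputable def metroF (am ap : ℝ) (x : ℤ) : ℝ :=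
  if x ≤ 0 then ((1 + |x| : ℤ) : ℝ) ^ am else ((1 + |x| : ℤ) : ℝ) ^ ap

/-- The probability measure on `{-N⁻,…,N⁺}` proportional to `metroF`. -/
noncomputable def metroPi (am ap : ℝ) (Nm Np : ℤ) (x : ℤ) : ℝ :=
  metroF am ap x / ∑ y ∈ Finset.Icc (-Nm) Np, metroF am ap y

/-- Dirichlet form of the Metropolis chain for `metroPi` based on
nearest-neighbor random walk on `{-N⁻,…,N⁺}`. -/
noncomputable def metroDirichlet (am ap : ℝ) (Nm Np : ℤ) (u : ℤ → ℝ) : ℝ :=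
  ∑ x ∈ Finset.Icc (-Nm) (Np - 1),
    (u (x + 1) - u x) ^ 2 *
      (1 / 2 * min (metroPi am ap Nm Np x) (metroPi am ap Nm Np (x + 1)))

/-- Variance with respect to `metroPi`. -/
noncomputable def metroVar (am ap : ℝ) (Nm Np : ℤ) (u : ℤ → ℝ) : ℝ :=
  ∑ x ∈ Finset.Icc (-Nm) Np,
    (u x - ∑ y ∈ Finset.Icc (-Nm) Np, u y * metroPi am ap Nm Np y) ^ 2 *
      metroPi am ap Nm Np x

/-- Spectral gap of the Metropolis chain:
`λ = inf { ℰ(u,u)/Var_π(u) : Var_π(u) ≠ 0 }`. -/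
noncomputable def metroGap (am ap : ℝ) (Nm Np : ℤ) : ℝ :=
  sInf {r : ℝ | ∃ u : ℤ → ℝ, metroVar am ap Nm Np u ≠ 0 ∧
    r = metroDirichlet am ap Nm Np u / metroVar am ap Nm Np u}

theorem metroF_of_nonpos (am ap : ℝ) {x : ℤ} (hx : x ≤ 0) :
    metroF am ap x = (1 - (x : ℝ)) ^ am := by
  simp [metroF, hx, abs_of_nonpos, sub_eq_add_neg]

theorem metroF_of_nonneg (am ap : ℝ) {x : ℤ} (hx : 0 ≤ x) :
    metroF am ap x = (1 + (x : ℝ)) ^ ap := by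
  rcases hx.eq_or_lt with rfl | h
  · simp [metroF]
  · simp [metroF, h.not_ge, abs_of_pos h]

theorem metroF_pos (am ap : ℝ) (x : ℤ) : 0 < metroF am ap x := by
  unfold metroF
  have : (0 : ℝ) < ((1 + |x| : ℤ) : ℝ) := by
    have := abs_nonneg x
    exact_mod_cast (by omega : 0 < 1 + |x|)
  split_ifs <;> positivity

theorem metroF_neg (am ap : ℝ) (x : ℤ) : metroF am ap (-x) = metroF ap am x := by
  rcases le_total 0 x with h | h
  · rw [metroF_of_nonpos _ _ (by omega), metroF_of_nonneg _ _ h]; simp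
  · rw [metroF_of_nonneg _ _ (by omega), metroF_of_nonpos _ _ h]; simp [sub_eq_add_neg]

theorem sum_metroF_pos (am ap : ℝ) {Nm Np : ℤ} (hm : 0 ≤ Nm) (hp : 0 ≤ Np) :
    0 < ∑ y ∈ Finset.Icc (-Nm) Np, metroF am ap y :=
  Finset.sum_pos (fun y _ => metroF_pos am ap y) ⟨0, by simp; omega⟩

theorem sum_Icc_neg_int (f : ℤ → ℝ) (p q : ℤ) :
    ∑ x ∈ Finset.Icc p q, f (-x) = ∑ x ∈ Finset.Icc (-q) (-p), f x := by
  refine Finset.sum_nbij' (fun x => -x) (fun x => -x) ?_ ?_ ?_ ?_ ?_ <;> simp <;> omega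

theorem metroPi_neg (am ap : ℝ) (Nm Np x : ℤ) :
    metroPi am ap Nm Np (-x) = metroPi ap am Np Nm x := by
  have h := sum_Icc_neg_int (metroF am ap) (-Np) Nm
  simp only [neg_neg] at h
  rw [metroPi, metroPi, ← h]
  simp only [metroF_neg]

theorem metroVar_reflect (am ap : ℝ) (Nm Np : ℤ) (u : ℤ → ℝ) :
    metroVar ap am Np Nm (fun x => u (-x)) = metroVar am ap Nm Np u := by
  unfold metroVar
  simp only [← metroPi_neg am ap Nm Np]
  rw [sum_Icc_neg_int (fun y => u y * metroPi am ap Nm Np y),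
    sum_Icc_neg_int (fun x => (u x - ∑ y ∈ Finset.Icc (-Nm) (- -Np),
      u y * metroPi am ap Nm Np y) ^ 2 * metroPi am ap Nm Np x)]
  simp only [neg_neg]

theorem metroDirichlet_reflect (am ap : ℝ) (Nm Np : ℤ) (u : ℤ → ℝ) :
    metroDirichlet ap am Np Nm (fun x => u (-x)) = metroDirichlet am ap Nm Np u := by
  unfold metroDirichlet
  refine Finset.sum_nbij' (fun x => -x - 1) (fun x => -x - 1) ?_ ?_ ?_ ?_ ?_
  · simp; omega
  · simp; omega
  · simp
  · simp
  · intro x _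
    simp only [← metroPi_neg am ap Nm Np]
    rw [show -x - 1 + 1 = -x by ring, show -(x + 1) = -x - 1 by ring, min_comm]
    ring

theorem metroGap_swap (am ap : ℝ) (Nm Np : ℤ) :
    metroGap ap am Np Nm = metroGap am ap Nm Np := by
  unfold metroGap
  congr 1
  ext r
  constructor
  · rintro ⟨u, hu, rfl⟩
    exact ⟨fun x => u (-x), by rwa [metroVar_reflect ap am Np Nm u],
      by rw [metroVar_reflect ap am Np Nm u, metroDirichlet_reflect ap am Np Nm u]⟩
  · rintro ⟨u, hu, rfl⟩
    exact ⟨fun x => u (-x), by rwa [metroVar_reflect am ap Nm Np u],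
      by rw [metroVar_reflect am ap Nm Np u, metroDirichlet_reflect am ap Nm Np u]⟩

theorem metroDirichlet_eq (am ap : ℝ) (Nm Np : ℤ) (u : ℤ → ℝ)
    (hm : 0 ≤ Nm) (hp : 0 ≤ Np) :
    metroDirichlet am ap Nm Np u =
      (∑ x ∈ Finset.Icc (-Nm) (Np - 1),
        (u (x + 1) - u x) ^ 2 * min (metroF am ap x) (metroF am ap (x + 1))) /
      (2 * ∑ y ∈ Finset.Icc (-Nm) Np, metroF am ap y) := by
  have hZ := sum_metroF_pos am ap hm hp
  unfold metroDirichlet metroPi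
  rw [Finset.sum_div]
  refine Finset.sum_congr rfl fun x _ => ?_
  rw [min_div_div_right hZ.le]
  field_simp

theorem metroVar_eq (am ap : ℝ) (Nm Np : ℤ) (u : ℤ → ℝ) :
    metroVar am ap Nm Np u =
      (∑ x ∈ Finset.Icc (-Nm) Np,
        (u x - ∑ y ∈ Finset.Icc (-Nm) Np, u y * metroPi am ap Nm Np y) ^ 2 * metroF am ap x) /
      ∑ y ∈ Finset.Icc (-Nm) Np, metroF am ap y := by
  unfold metroVar
  rw [Finset.sum_div]
  refine Finset.sum_congr rfl fun x _ => ?_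
  rw [metroPi]
  ring

/-- The mean minimizes the quadratic deviation. -/
theorem metroVar_le (am ap : ℝ) (Nm Np : ℤ) (u : ℤ → ℝ) (hm : 0 ≤ Nm) (hp : 0 ≤ Np) (c : ℝ) :
    metroVar am ap Nm Np u ≤
      (∑ x ∈ Finset.Icc (-Nm) Np, (u x - c) ^ 2 * metroF am ap x) /
      ∑ y ∈ Finset.Icc (-Nm) Np, metroF am ap y := by
  have hZ := sum_metroF_pos am ap hm hp
  have h1 : ∑ x ∈ Finset.Icc (-Nm) Np, metroPi am ap Nm Np x = 1 := by
    simp only [metroPi, ← Finset.sum_div]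
    exact div_self hZ.ne'
  have h2 : (∑ x ∈ Finset.Icc (-Nm) Np, (u x - c) ^ 2 * metroF am ap x) /
      ∑ y ∈ Finset.Icc (-Nm) Np, metroF am ap y =
      ∑ x ∈ Finset.Icc (-Nm) Np, (u x - c) ^ 2 * metroPi am ap Nm Np x := by
    rw [Finset.sum_div]
    exact Finset.sum_congr rfl fun x _ => by rw [metroPi]; ring
  rw [h2, metroVar]
  set m := ∑ y ∈ Finset.Icc (-Nm) Np, u y * metroPi am ap Nm Np y with hmdef
  have key : ∑ x ∈ Finset.Icc (-Nm) Np, (u x - c) ^ 2 * metroPi am ap Nm Np x =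
      ∑ x ∈ Finset.Icc (-Nm) Np, (u x - m) ^ 2 * metroPi am ap Nm Np x +
      (2 * (m - c) * ∑ x ∈ Finset.Icc (-Nm) Np, u x * metroPi am ap Nm Np x +
        (c ^ 2 - m ^ 2) * ∑ x ∈ Finset.Icc (-Nm) Np, metroPi am ap Nm Np x) := by
    rw [Finset.mul_sum, Finset.mul_sum, ← Finset.sum_add_distrib, ← Finset.sum_add_distrib]
    exact Finset.sum_congr rfl fun x _ => by ring
  rw [key, ← hmdef, h1]
  nlinarith [sq_nonneg (m - c)]

theorem sum_Icc_add_one_right (f : ℤ → ℝ) {p q : ℤ} (h : p ≤ q + 1) :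
    ∑ x ∈ Finset.Icc p (q + 1), f x = ∑ x ∈ Finset.Icc p q, f x + f (q + 1) := by
  have : Finset.Icc p (q + 1) = insert (q + 1) (Finset.Icc p q) := by ext; simp; omega
  rw [this, Finset.sum_insert (by simp), add_comm]

theorem sum_Icc_sub_one_left (f : ℤ → ℝ) {p q : ℤ} (h : p - 1 ≤ q) :
    ∑ x ∈ Finset.Icc (p - 1) q, f x = ∑ x ∈ Finset.Icc p q, f x + f (p - 1) := by
  have : Finset.Icc (p - 1) q = insert (p - 1) (Finset.Icc p q) := by ext; simp; omega
  rw [this, Finset.sum_insert (by simp), add_comm]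

theorem sum_Icc_telescope (u : ℤ → ℝ) {p q : ℤ} (h : p ≤ q) :
    ∑ x ∈ Finset.Icc p (q - 1), (u (x + 1) - u x) = u q - u p := by
  induction q, h using Int.leInduction with
  | base => simp
  | succ q hq ih =>
    rw [show q + 1 - 1 = (q - 1) + 1 by ring, sum_Icc_add_one_right _ (by omega), ih]
    simp

/-- Discrete comparison of `(n+1)^{-a}` with the increment of `x^{1-a}/(1-a)`. -/
theorem natCast_rpow_add_mul_inv_le {a : ℝ} (h0 : 0 ≤ a) (h1 : a < 1) (n : ℕ) :
    (n : ℝ) ^ (1 - a) + (1 - a) * ((1 + (n : ℝ)) ^ a)⁻¹ ≤ ((n + 1 : ℕ) : ℝ) ^ (1 - a) := by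
  have hn : (0 : ℝ) < 1 + n := by positivity
  have hb := rpow_one_add_le_one_add_mul_self (s := -(1 + (n : ℝ))⁻¹)
    (by rw [neg_le_neg_iff]; exact inv_le_one_of_one_le₀ (by simp))
    (p := 1 - a) (by linarith) (by linarith)
  have e : 1 + -(1 + (n : ℝ))⁻¹ = n / (1 + n) := by field_simp; ring
  rw [e, Real.div_rpow (by positivity) hn.le, div_le_iff₀ (by positivity)] at hb
  have e2 : (1 + (n : ℝ))⁻¹ * (1 + (n : ℝ)) ^ (1 - a) = ((1 + (n : ℝ)) ^ a)⁻¹ := by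
    rw [Real.rpow_sub hn, Real.rpow_one]
    field_simp
  rw [show ((n + 1 : ℕ) : ℝ) = 1 + n by push_cast; ring]
  linear_combination hb - (1 - a) * e2

theorem min_metroF_of_nonneg (am : ℝ) {ap : ℝ} (hap : 0 ≤ ap) {x : ℤ} (hx : 0 ≤ x) :
    min (metroF am ap x) (metroF am ap (x + 1)) = (1 + (x : ℝ)) ^ ap := by
  have h : (0 : ℝ) ≤ x := by exact_mod_cast hx
  rw [metroF_of_nonneg _ _ hx, metroF_of_nonneg _ _ (by omega)]
  exact min_eq_left (Real.rpow_le_rpow (by linarith) (by push_cast; linarith) hap)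

theorem min_metroF_of_neg {am : ℝ} (ap : ℝ) (ham : 0 ≤ am) {x : ℤ} (hx : x < 0) :
    min (metroF am ap x) (metroF am ap (x + 1)) = (-(x : ℝ)) ^ am := by
  have h : (x : ℝ) < 0 := by exact_mod_cast hx
  rw [metroF_of_nonpos _ _ hx.le, metroF_of_nonpos _ _ (by omega)]
  have e : 1 - ((x + 1 : ℤ) : ℝ) = -x := by push_cast; ring
  rw [e]
  exact min_eq_right (Real.rpow_le_rpow (by linarith) (by linarith) ham)

theorem min_metroF_pos (am ap : ℝ) (x : ℤ) :
    0 < min (metroF am ap x) (metroF am ap (x + 1)) :=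
  lt_min (metroF_pos _ _ _) (metroF_pos _ _ _)

/-- Bound on the total resistance of the chain. -/
theorem sum_inv_min_metroF_le {am ap : ℝ} (ham : 0 ≤ am) (h1 : am < 1) (hle : am ≤ ap)
    (n m : ℕ) :
    ∑ x ∈ Finset.Icc (-(n : ℤ)) (m - 1), (min (metroF am ap x) (metroF am ap (x + 1)))⁻¹ ≤
      ((n : ℝ) ^ (1 - am) + (m : ℝ) ^ (1 - am)) / (1 - am) := by
  have ha : 0 < 1 - am := by linarith
  rw [le_div_iff₀ ha]
  induction n with
  | zero =>
    induction m with
    | zero => simp [Real.zero_rpow ha.ne']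
    | succ m ih =>
      rw [show ((m + 1 : ℕ) : ℤ) - 1 = ((m : ℤ) - 1) + 1 by push_cast; ring,
        sum_Icc_add_one_right _ (by push_cast; omega), add_mul, sub_add_cancel,
        min_metroF_of_nonneg _ (ham.trans hle) (by omega)]
      have hm := natCast_rpow_add_mul_inv_le ham h1 m
      have : ((1 + ((m : ℤ) : ℝ)) ^ ap)⁻¹ ≤ ((1 + (m : ℝ)) ^ am)⁻¹ := by
        have : (1 : ℝ) ≤ 1 + m := by simp
        push_cast
        gcongr
      nlinarith
  | succ n ih =>
    rw [show -((n + 1 : ℕ) : ℤ) = -(n : ℤ) - 1 by push_cast; ring,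
      sum_Icc_sub_one_left _ (by omega), add_mul, min_metroF_of_neg _ ham (by omega)]
    have hn := natCast_rpow_add_mul_inv_le ham h1 n
    have e : -((-(n : ℤ) - 1 : ℤ) : ℝ) = 1 + n := by push_cast; ring
    rw [e]
    linarith

theorem metroF_mul_sum_inv_le {am ap : ℝ} (ham : 0 ≤ am) (h1 : am < 1) (hle : am ≤ ap)
    {Nm Np : ℤ} (hm : 0 ≤ Nm) (hp : 0 ≤ Np) (hN : 1 ≤ Nm + Np) {x : ℤ} (hx : -Nm ≤ x)
    (hx' : x ≤ Np) :
    metroF am ap x *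
        ∑ y ∈ Finset.Icc x (Np - 1), (min (metroF am ap y) (metroF am ap (y + 1)))⁻¹ ≤
      4 * ((Nm : ℝ) + Np) / (1 - am) := by
  have ha : 0 < 1 - am := by linarith
  have hmR : (0 : ℝ) ≤ Nm := by exact_mod_cast hm
  have hpR : (0 : ℝ) ≤ Np := by exact_mod_cast hp
  have hNR : (1 : ℝ) ≤ (Nm : ℝ) + Np := by exact_mod_cast hN
  set L : ℝ := (Nm : ℝ) + Np with hL
  rcases le_total x 0 with h | h
  · have hF : metroF am ap x ≤ 2 * L ^ am := by
      have hxR : (x : ℝ) ≤ 0 := by exact_mod_cast h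
      have hxR' : -(Nm : ℝ) ≤ x := by exact_mod_cast hx
      rw [metroF_of_nonpos _ _ h]
      calc (1 - (x : ℝ)) ^ am ≤ (2 * L) ^ am :=
            Real.rpow_le_rpow (by linarith) (by linarith) ham
        _ = 2 ^ am * L ^ am := Real.mul_rpow (by norm_num) (by linarith)
        _ ≤ 2 * L ^ am := by
            gcongr
            calc (2 : ℝ) ^ am ≤ 2 ^ (1 : ℝ) :=
                  Real.rpow_le_rpow_of_exponent_le (by norm_num) h1.le
              _ = 2 := Real.rpow_one 2
    have hR : ∑ y ∈ Finset.Icc x (Np - 1), (min (metroF am ap y) (metroF am ap (y + 1)))⁻¹ ≤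
        2 * L ^ (1 - am) / (1 - am) := by
      obtain ⟨n, rfl⟩ := Int.eq_ofNat_of_zero_le hm
      obtain ⟨m, rfl⟩ := Int.eq_ofNat_of_zero_le hp
      push_cast at hL hmR hpR
      calc _ ≤ ∑ y ∈ Finset.Icc (-(n : ℤ)) (m - 1),
              (min (metroF am ap y) (metroF am ap (y + 1)))⁻¹ :=
            Finset.sum_le_sum_of_subset_of_nonneg (Finset.Icc_subset_Icc_left hx)
              fun y _ _ => (inv_pos.2 (min_metroF_pos _ _ _)).le
        _ ≤ _ := sum_inv_min_metroF_le ham h1 hle n m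
        _ ≤ _ := by
            gcongr
            have i1 : (n : ℝ) ^ (1 - am) ≤ L ^ (1 - am) :=
              Real.rpow_le_rpow hmR (by linarith) ha.le
            have i2 : (m : ℝ) ^ (1 - am) ≤ L ^ (1 - am) :=
              Real.rpow_le_rpow hpR (by linarith) ha.le
            linarith
    calc _ ≤ (2 * L ^ am) * (2 * L ^ (1 - am) / (1 - am)) := by
          gcongr
          exact Finset.sum_nonneg fun y _ => (inv_pos.2 (min_metroF_pos _ _ _)).le
      _ = 4 * (L ^ am * L ^ (1 - am)) / (1 - am) := by ring
      _ = 4 * L / (1 - am) := by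
          rw [← Real.rpow_add (by linarith)]; simp
  · have hxR : (0 : ℝ) ≤ x := by exact_mod_cast h
    have hxR' : (x : ℝ) ≤ Np := by exact_mod_cast hx'
    calc _ = ∑ y ∈ Finset.Icc x (Np - 1),
            metroF am ap x * (min (metroF am ap y) (metroF am ap (y + 1)))⁻¹ :=
          Finset.mul_sum _ _ _
      _ ≤ ∑ y ∈ Finset.Icc x (Np - 1), 1 := by
          refine Finset.sum_le_sum fun y hy => ?_
          have hy := (Finset.mem_Icc.1 hy).1
          have hyR : (x : ℝ) ≤ y := by exact_mod_cast hy
          rw [min_metroF_of_nonneg _ (ham.trans hle) (h.trans hy), metroF_of_nonneg _ _ h,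
            ← div_eq_mul_inv]
          exact div_le_one_of_le₀
            (Real.rpow_le_rpow (by linarith) (by linarith) (ham.trans hle))
            (Real.rpow_nonneg (by linarith) _)
      _ = (Np : ℝ) - x := by
          simp only [Finset.sum_const, Int.card_Icc, sub_add_cancel, nsmul_eq_mul, mul_one]
          have : ((Np - x).toNat : ℤ) = Np - x := Int.toNat_of_nonneg (by omega)
          exact_mod_cast this
      _ ≤ 4 * L / (1 - am) := by
          rw [le_div_iff₀ ha]
          nlinarith

/-- Poincaré inequality, centered at the endpoint on the side with the larger exponent. -/
theorem metroVar_le_metroDirichlet {am ap : ℝ} (ham : 0 ≤ am) (h1 : am < 1) (hle : am ≤ ap)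
    {Nm Np : ℤ} (hm : 0 ≤ Nm) (hp : 0 ≤ Np) (hN : 1 ≤ Nm + Np) (u : ℤ → ℝ) :
    metroVar am ap Nm Np u ≤
      16 / (1 - am) * ((Nm : ℝ) + Np) ^ 2 * metroDirichlet am ap Nm Np u := by
  have ha : 0 < 1 - am := by linarith
  have hNR : (1 : ℝ) ≤ (Nm : ℝ) + Np := by exact_mod_cast hN
  have hZ := sum_metroF_pos am ap hm hp
  refine (metroVar_le am ap Nm Np u hm hp (u Np)).trans ?_
  rw [metroDirichlet_eq am ap Nm Np u hm hp]
  set w : ℤ → ℝ := fun x => min (metroF am ap x) (metroF am ap (x + 1)) with hw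
  have hwpos : ∀ x, 0 < w x := min_metroF_pos am ap
  set E := ∑ x ∈ Finset.Icc (-Nm) (Np - 1), (u (x + 1) - u x) ^ 2 * w x with hE
  have hE0 : 0 ≤ E := Finset.sum_nonneg fun x _ => mul_nonneg (sq_nonneg _) (hwpos x).le
  have pt : ∀ x ∈ Finset.Icc (-Nm) Np, (u x - u Np) ^ 2 * metroF am ap x ≤
      4 * ((Nm : ℝ) + Np) / (1 - am) * E := by
    intro x hx
    rw [Finset.mem_Icc] at hx
    have cs : (u x - u Np) ^ 2 ≤ (∑ y ∈ Finset.Icc x (Np - 1), (w y)⁻¹) * E := by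
      rw [← neg_sq, neg_sub, ← sum_Icc_telescope u hx.2]
      calc _ ≤ (∑ y ∈ Finset.Icc x (Np - 1), (w y)⁻¹) *
              ∑ y ∈ Finset.Icc x (Np - 1), (u (y + 1) - u y) ^ 2 * w y := by
            refine Finset.sum_sq_le_sum_mul_sum_of_sq_le_mul _
              (fun y _ => (inv_pos.2 (hwpos y)).le)
              (fun y _ => mul_nonneg (sq_nonneg _) (hwpos y).le) fun y _ => ?_
            refine le_of_eq ?_
            have := (hwpos y).ne'
            field_simp
        _ ≤ _ := by
            refine mul_le_mul_of_nonneg_left ?_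
              (Finset.sum_nonneg fun y _ => (inv_pos.2 (hwpos y)).le)
            exact Finset.sum_le_sum_of_subset_of_nonneg (Finset.Icc_subset_Icc_left hx.1)
              fun y _ _ => mul_nonneg (sq_nonneg _) (hwpos y).le
    have hR := metroF_mul_sum_inv_le ham h1 hle hm hp hN hx.1 hx.2
    calc _ ≤ (∑ y ∈ Finset.Icc x (Np - 1), (w y)⁻¹) * E * metroF am ap x :=
          mul_le_mul_of_nonneg_right cs (metroF_pos _ _ _).le
      _ = (metroF am ap x * ∑ y ∈ Finset.Icc x (Np - 1), (w y)⁻¹) * E := by ring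
      _ ≤ _ := mul_le_mul_of_nonneg_right hR hE0
  have hs := Finset.sum_le_sum pt
  have hcard : ((Finset.Icc (-Nm) Np).card : ℝ) ≤ 2 * ((Nm : ℝ) + Np) := by
    have : ((Finset.Icc (-Nm) Np).card : ℤ) ≤ 2 * (Nm + Np) := by
      rw [Int.card_Icc]; omega
    exact_mod_cast this
  rw [Finset.sum_const, nsmul_eq_mul] at hs
  rw [div_le_iff₀ hZ]
  calc _ ≤ _ := hs
    _ ≤ 2 * ((Nm : ℝ) + Np) * (4 * ((Nm : ℝ) + Np) / (1 - am) * E) := by gcongr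
    _ = _ := by field_simp; ring

theorem sum_Icc_sub_sq_ge (p : ℤ) (n : ℕ) (c : ℝ) :
    (n : ℝ) ^ 3 / 12 ≤ ∑ x ∈ Finset.Icc p (p + n), ((x : ℝ) - c) ^ 2 := by
  have h : ∑ x ∈ Finset.Icc p (p + n), ((x : ℝ) - c) ^ 2 =
      (n + 1) * (p - c + n / 2) ^ 2 + n * (n + 1) * (n + 2) / 12 := by
    induction n with
    | zero => simp
    | succ n ih =>
      rw [show p + ((n + 1 : ℕ) : ℤ) = p + n + 1 by push_cast; ring,
        sum_Icc_add_one_right _ (by omega), ih]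
      push_cast
      ring
  rw [h]
  have hn : (0 : ℝ) ≤ n := by positivity
  nlinarith [mul_nonneg (add_nonneg hn zero_le_one) (sq_nonneg ((p : ℝ) - c + n / 2)),
    sq_nonneg (n : ℝ)]

/-- Test function `max x 0` for the longer side. -/
theorem exists_metroDirichlet_le {ap : ℝ} (am : ℝ) (hap : 0 ≤ ap)
    {Nm Np : ℤ} (hm : 0 ≤ Nm) (hle : Nm ≤ Np) (hN : 1 ≤ Nm + Np) :
    ∃ u, 0 < metroVar am ap Nm Np u ∧
      metroDirichlet am ap Nm Np u ≤
        192 * 2 ^ ap / ((Nm : ℝ) + Np) ^ 2 * metroVar am ap Nm Np u := by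
  have hp : 0 ≤ Np := hm.trans hle
  have hp1 : (1 : ℝ) ≤ Np := by exact_mod_cast (by omega : 1 ≤ Np)
  have hmR : (0 : ℝ) ≤ Nm := by exact_mod_cast hm
  have hleR : (Nm : ℝ) ≤ Np := by exact_mod_cast hle
  have hZ := sum_metroF_pos am ap hm hp
  set u : ℤ → ℝ := fun x => ((max x 0 : ℤ) : ℝ) with hu
  have hD : ∑ x ∈ Finset.Icc (-Nm) (Np - 1),
      (u (x + 1) - u x) ^ 2 * min (metroF am ap x) (metroF am ap (x + 1)) ≤
      Np * (1 + (Np : ℝ)) ^ ap := by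
    have hsub : Finset.Icc 0 (Np - 1) ⊆ Finset.Icc (-Nm) (Np - 1) :=
      Finset.Icc_subset_Icc_left (by omega)
    rw [← Finset.sum_subset hsub]
    · calc _ ≤ ∑ x ∈ Finset.Icc 0 (Np - 1), (1 + (Np : ℝ)) ^ ap := by
            refine Finset.sum_le_sum fun x hx => ?_
            rw [Finset.mem_Icc] at hx
            have hxR : (0 : ℝ) ≤ x := by exact_mod_cast hx.1
            have hxR' : (x : ℝ) ≤ Np := by exact_mod_cast (by omega : x ≤ Np)
            rw [min_metroF_of_nonneg _ hap hx.1]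
            have e : u (x + 1) - u x = 1 := by
              simp only [hu]
              rw [max_eq_left hx.1, max_eq_left (by omega : (0 : ℤ) ≤ x + 1)]
              push_cast; ring
            rw [e, one_pow, one_mul]
            exact Real.rpow_le_rpow (by linarith) (by linarith) hap
        _ = _ := by
            simp only [Finset.sum_const, Int.card_Icc, nsmul_eq_mul]
            congr 1
            have : ((Np - 1 + 1 - 0).toNat : ℤ) = Np := by omega
            exact_mod_cast this
    · intro x _ hx
      rename_i hx0
      simp only [Finset.mem_Icc] at hx hx0
      have e : u (x + 1) - u x = 0 := by
        simp only [hu]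
        rw [max_eq_right (by omega : x ≤ 0), max_eq_right (by omega : x + 1 ≤ 0), sub_self]
      rw [e]; simp
  have hV : ∀ c : ℝ, (1 + (Np : ℝ)) ^ ap / 2 ^ ap * (Np ^ 3 / 96) ≤
      ∑ x ∈ Finset.Icc (-Nm) Np, (u x - c) ^ 2 * metroF am ap x := by
    intro c
    obtain ⟨n, hn⟩ := Int.eq_ofNat_of_zero_le (by omega : 0 ≤ Np - Np / 2)
    have hn2 : (Np : ℝ) / 2 ≤ n := by
      have : Np ≤ 2 * (n : ℤ) := by omega
      have : (Np : ℝ) ≤ 2 * n := by exact_mod_cast this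
      linarith
    have hs := sum_Icc_sub_sq_ge (Np / 2) n c
    rw [show Np / 2 + (n : ℤ) = Np by omega] at hs
    have h3 : (Np : ℝ) ^ 3 / 96 ≤ (n : ℝ) ^ 3 / 12 := by
      have : ((Np : ℝ) / 2) ^ 3 ≤ (n : ℝ) ^ 3 := by gcongr
      linarith
    calc _ ≤ (1 + (Np : ℝ)) ^ ap / 2 ^ ap *
            ∑ x ∈ Finset.Icc (Np / 2) Np, ((x : ℝ) - c) ^ 2 := by
          gcongr; exact h3.trans hs
      _ = ∑ x ∈ Finset.Icc (Np / 2) Np, (1 + (Np : ℝ)) ^ ap / 2 ^ ap * ((x : ℝ) - c) ^ 2 :=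
          Finset.mul_sum _ _ _
      _ ≤ ∑ x ∈ Finset.Icc (Np / 2) Np, (u x - c) ^ 2 * metroF am ap x := by
          refine Finset.sum_le_sum fun x hx => ?_
          rw [Finset.mem_Icc] at hx
          have hx0 : 0 ≤ x := by omega
          have hxR : (Np : ℝ) ≤ 2 * x + 1 := by exact_mod_cast (by omega : Np ≤ 2 * x + 1)
          rw [metroF_of_nonneg _ _ hx0, show u x = x by simp only [hu]; rw [max_eq_left hx0],
            mul_comm, ← Real.div_rpow (by linarith) (by norm_num)]
          refine mul_le_mul_of_nonneg_left ?_ (sq_nonneg _)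
          exact Real.rpow_le_rpow (by linarith) (by linarith) hap
      _ ≤ _ := Finset.sum_le_sum_of_subset_of_nonneg
          (Finset.Icc_subset_Icc_left (by omega))
          fun x _ _ => mul_nonneg (sq_nonneg _) (metroF_pos _ _ _).le
  refine ⟨u, ?_, ?_⟩
  · rw [metroVar_eq]
    refine div_pos (lt_of_lt_of_le ?_ (hV _)) hZ
    positivity
  · rw [metroDirichlet_eq am ap Nm Np u hm hp, metroVar_eq, div_mul_div_comm,
      div_le_div_iff₀ (by positivity) (by positivity)]
    set Z := ∑ y ∈ Finset.Icc (-Nm) Np, metroF am ap y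
    have hV' := hV (∑ y ∈ Finset.Icc (-Nm) Np, u y * metroPi am ap Nm Np y)
    set V := ∑ x ∈ Finset.Icc (-Nm) Np,
      (u x - ∑ y ∈ Finset.Icc (-Nm) Np, u y * metroPi am ap Nm Np y) ^ 2 * metroF am ap x
    have hL : ((Nm : ℝ) + Np) ^ 2 ≤ 4 * (Np : ℝ) ^ 2 := by nlinarith
    calc _ ≤ (Np * (1 + (Np : ℝ)) ^ ap) * ((4 * (Np : ℝ) ^ 2) * Z) := by gcongr
      _ = 192 * 2 ^ ap * ((1 + (Np : ℝ)) ^ ap / 2 ^ ap * (Np ^ 3 / 96)) * (2 * Z) := by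
          field_simp; ring
      _ ≤ 192 * 2 ^ ap * V * (2 * Z) := by gcongr

theorem metroVar_nonneg (am ap : ℝ) (Nm Np : ℤ) (u : ℤ → ℝ) : 0 ≤ metroVar am ap Nm Np u :=
  Finset.sum_nonneg fun _ _ => mul_nonneg (sq_nonneg _)
    (div_nonneg (metroF_pos _ _ _).le (Finset.sum_nonneg fun _ _ => (metroF_pos _ _ _).le))

theorem metroDirichlet_nonneg (am ap : ℝ) (Nm Np : ℤ) (u : ℤ → ℝ) :
    0 ≤ metroDirichlet am ap Nm Np u := by
  have hpi : ∀ x, 0 ≤ metroPi am ap Nm Np x := fun x =>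
    div_nonneg (metroF_pos _ _ _).le (Finset.sum_nonneg fun y _ => (metroF_pos _ _ _).le)
  exact Finset.sum_nonneg fun x _ => mul_nonneg (sq_nonneg _)
    (mul_nonneg (by norm_num) (le_min (hpi _) (hpi _)))

theorem metroGap_le_of_le {ap : ℝ} (am : ℝ) (hap : 0 ≤ ap)
    {Nm Np : ℤ} (hm : 0 ≤ Nm) (hle : Nm ≤ Np) (hN : 1 ≤ Nm + Np) :
    metroGap am ap Nm Np ≤ 192 * 2 ^ ap / ((Nm : ℝ) + Np) ^ 2 := by
  obtain ⟨u, hu, h⟩ := exists_metroDirichlet_le am hap hm hle hN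
  refine le_trans (csInf_le ?_ ⟨u, hu.ne', rfl⟩) ((div_le_iff₀ hu).2 h)
  refine ⟨0, ?_⟩
  rintro r ⟨v, -, rfl⟩
  exact div_nonneg (metroDirichlet_nonneg _ _ _ _ _) (metroVar_nonneg _ _ _ _ _)

theorem exists_metroVar_pos {am ap : ℝ} (ham : 0 ≤ am) (hap : 0 ≤ ap)
    {Nm Np : ℤ} (hm : 0 ≤ Nm) (hp : 0 ≤ Np) (hN : 1 ≤ Nm + Np) :
    ∃ u, 0 < metroVar am ap Nm Np u := by
  rcases le_total Nm Np with h | h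
  · obtain ⟨u, hu, -⟩ := exists_metroDirichlet_le am hap hm h hN
    exact ⟨u, hu⟩
  · obtain ⟨u, hu, -⟩ := exists_metroDirichlet_le ap ham hp h (by omega)
    exact ⟨fun x => u (-x), by rwa [metroVar_reflect ap am Np Nm u]⟩

theorem le_metroGap_of_le {am ap : ℝ} (ham : 0 ≤ am) (h1 : am < 1) (hle : am ≤ ap)
    {Nm Np : ℤ} (hm : 0 ≤ Nm) (hp : 0 ≤ Np) (hN : 1 ≤ Nm + Np) :
    (1 - am) / 16 / ((Nm : ℝ) + Np) ^ 2 ≤ metroGap am ap Nm Np := by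
  have ha : 0 < 1 - am := by linarith
  have hNR : (1 : ℝ) ≤ (Nm : ℝ) + Np := by exact_mod_cast hN
  obtain ⟨u, hu⟩ := exists_metroVar_pos ham (ham.trans hle) hm hp hN
  refine le_csInf ⟨_, u, hu.ne', rfl⟩ ?_
  rintro r ⟨v, hv, rfl⟩
  have hv' := (metroVar_nonneg am ap Nm Np v).lt_of_ne' hv
  have h := metroVar_le_metroDirichlet ham h1 hle hm hp hN v
  have hL : (0 : ℝ) < ((Nm : ℝ) + Np) ^ 2 := by positivity
  rw [div_div, div_le_div_iff₀ (by positivity) hv']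
  calc _ ≤ (1 - am) *
        (16 / (1 - am) * ((Nm : ℝ) + Np) ^ 2 * metroDirichlet am ap Nm Np v) := by gcongr
    _ = _ := by field_simp

/-- Lemma `lem-2`, second case: if `min{a⁻,a⁺} ∈ (0,1)` then the
spectral gap of the asymmetric chain on `{-N⁻,…,N⁺}` is of order
`(N⁻+N⁺)^{-2}`. -/
theorem gap_asymmetric_subcritical (am ap : ℝ) (ham : 0 ≤ am) (hap : 0 ≤ ap)
    (hmin0 : 0 < min am ap) (hmin1 : min am ap < 1) :
    ∃ c C : ℝ, 0 < c ∧ 0 < C ∧ ∀ Nm Np : ℤ, 0 ≤ Nm → 0 ≤ Np → 1 ≤ Nm + Np →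
      c / ((Nm : ℝ) + (Np : ℝ)) ^ 2 ≤ metroGap am ap Nm Np ∧
      metroGap am ap Nm Np ≤ C / ((Nm : ℝ) + (Np : ℝ)) ^ 2 := by
  have hup : ∀ Nm Np : ℤ, 0 ≤ Nm → 0 ≤ Np → 1 ≤ Nm + Np →
      metroGap am ap Nm Np ≤ 192 * (2 ^ am + 2 ^ ap) / ((Nm : ℝ) + (Np : ℝ)) ^ 2 := by
    intro Nm Np hm hp hN
    have i1 : (0 : ℝ) < 2 ^ am := by positivity
    have i2 : (0 : ℝ) < 2 ^ ap := by positivity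
    rcases le_total Nm Np with h | h
    · refine (metroGap_le_of_le am hap hm h hN).trans ?_
      gcongr
      linarith
    · rw [← metroGap_swap, add_comm (Nm : ℝ)]
      refine (metroGap_le_of_le ap ham hp h (by omega)).trans ?_
      gcongr
      linarith
  refine ⟨(1 - min am ap) / 16, 192 * (2 ^ am + 2 ^ ap), by linarith, by positivity,
    fun Nm Np hm hp hN => ⟨?_, hup Nm Np hm hp hN⟩⟩
  rcases le_total am ap with h | h
  · rw [min_eq_left h] at hmin1 ⊢
    exact le_metroGap_of_le ham hmin1 h hm hp hN
  · rw [min_eq_right h] at hmin1 ⊢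
    rw [← metroGap_swap, add_comm (Nm : ℝ)]
    exact le_metroGap_of_le hap hmin1 h hp hm (by omega)
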